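/- arXiv:1606.05115 — 2 statements merged into one kernel-verified Lean document; each statement's English description precedes it below -/
import Mathlib

section
/- (Elliott's identity.) Let a, c be real numbers with |a| < 1/2 and |c| < 1/2, let b > −1/2, and let x ∈ (0,1). Define F(α,β;γ;y) = Σ_{n=0}^{∞} (α)_n (β)_n / ((γ)_n · n!) · y^n for |y| < 1, where (x)_n is the ascending Pochhammer symbol. Then F(1/2+a, −1/2−c; a+b+1; x)·F(1/2−a, 1/2+c; b+c+1; 1−x) + F(1/2+a, 1/2−c; a+b+1; x)·F(−1/2−a, 1/2+c; b+c+1; 1−x) − F(1/2+a, 1/2−c; a+b+1; x)·F(1/2−a, 1/2+c; b+c+1; 1−x) = Γ(a+b+1)·Γ(b+c+1)/(Γ(a+b+c+3/2)·Γ(b+1/2)), where Γ is the Gamma function. -/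
open Real Set Filter Polynomial

/-- The Gaussian hypergeometric function, defined by its power series
(convergent for `|y| < 1`). -/
noncomputable def hypergeom (α β γ y : ℝ) : ℝ :=
  ∑' n : ℕ, (ascPochhammer ℝ n).eval α * (ascPochhammer ℝ n).eval β
    / ((ascPochhammer ℝ n).eval γ * (n.factorial : ℝ)) * y ^ n

noncomputable def hco (α β γ : ℝ) (n : ℕ) : ℝ :=
  (ascPochhammer ℝ n).eval α * (ascPochhammer ℝ n).eval β
    / ((ascPochhammer ℝ n).eval γ * (n.factorial : ℝ))

lemma hypergeom_eq (α β γ y : ℝ) : hypergeom α β γ y = ∑' n, hco α β γ n * y ^ n := rfl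

lemma hco_symm (α β γ : ℝ) (n : ℕ) : hco α β γ n = hco β α γ n := by
  unfold hco; rw [mul_comm ((ascPochhammer ℝ n).eval α)]

lemma hypergeom_symm (α β γ y : ℝ) : hypergeom α β γ y = hypergeom β α γ y := by
  simp only [hypergeom_eq, hco_symm α β γ]

lemma hco_zero (α β γ : ℝ) : hco α β γ 0 = 1 := by simp [hco]

lemma poch_pos {γ : ℝ} (h : 0 < γ) (n : ℕ) : 0 < (ascPochhammer ℝ n).eval γ :=
  ascPochhammer_pos n γ h

lemma hco_succ {γ : ℝ} (α β : ℝ) (h : 0 < γ) (n : ℕ) :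
    hco α β γ (n + 1) * ((γ + n) * (n + 1)) = hco α β γ n * ((α + n) * (β + n)) := by
  have h1 := (poch_pos h n).ne'
  have h2 : γ + n ≠ 0 := by positivity
  have h3 : (n.factorial : ℝ) ≠ 0 := by positivity
  unfold hco
  rw [Nat.factorial_succ]
  push_cast
  simp only [ascPochhammer_succ_eval]
  field_simp

lemma poch_shift (β : ℝ) (n : ℕ) :
    (ascPochhammer ℝ (n + 1)).eval (β - 1) = (β - 1) * (ascPochhammer ℝ n).eval β := by
  rw [ascPochhammer_succ_left]
  simp

lemma hco_shift (α β γ : ℝ) (n : ℕ) :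
    hco α (β - 1) γ n * (β - 1 + n) = (β - 1) * hco α β γ n := by
  unfold hco
  have := poch_shift β n
  rw [ascPochhammer_succ_eval] at this
  rw [div_mul_eq_mul_div, mul_assoc, this]; ring

lemma hco_rec (α β γ : ℝ) (h : 0 < γ) (n : ℕ) :
    (n + 1) * hco α β γ (n + 1) - n * hco α β γ n =
      (γ - β) * hco α (β - 1) γ (n + 1) + (β - γ) * hco α β γ (n + 1) + α * hco α β γ n := by
  have h1 := (poch_pos h n).ne'
  have h2 : γ + n ≠ 0 := by positivity
  have h3 : (n.factorial : ℝ) ≠ 0 := by positivity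
  unfold hco
  rw [Nat.factorial_succ, poch_shift]
  push_cast
  simp only [ascPochhammer_succ_eval]
  field_simp
  ring

lemma abs_poch_le_fact {β : ℝ} (h1 : -1 ≤ β) (h2 : β ≤ 1) (n : ℕ) :
    |(ascPochhammer ℝ n).eval β| ≤ n.factorial := by
  induction n with
  | zero => simp
  | succ n ih =>
    rw [ascPochhammer_succ_eval, abs_mul, Nat.factorial_succ, mul_comm]
    push_cast
    have : |β + n| ≤ n + 1 := by
      have : (0:ℝ) ≤ n := n.cast_nonneg
      rw [abs_le]; constructor <;> linarith
    gcongr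

lemma poch_mono {α γ : ℝ} (h1 : 0 < α) (h2 : α ≤ γ) (n : ℕ) :
    (ascPochhammer ℝ n).eval α ≤ (ascPochhammer ℝ n).eval γ := by
  induction n with
  | zero => simp
  | succ n ih =>
    simp only [ascPochhammer_succ_eval]
    have := poch_pos h1 n
    have := poch_pos (h1.trans_le h2) n
    gcongr

lemma abs_hco_le {α β γ : ℝ} (h1 : 0 < α) (h2 : α ≤ γ) (h3 : -1 ≤ β) (h4 : β ≤ 1) (n : ℕ) :
    |hco α β γ n| ≤ 1 := by
  unfold hco
  have := poch_pos h1 n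
  have := poch_pos (h1.trans_le h2) n
  rw [abs_div, abs_mul, abs_mul, abs_of_pos (poch_pos h1 n),
    abs_of_pos (poch_pos (h1.trans_le h2) n), Nat.abs_cast]
  apply div_le_one_of_le₀ _ (by positivity)
  exact mul_le_mul (poch_mono h1 h2 n) (abs_poch_le_fact h3 h4 n) (abs_nonneg _) (by positivity)

lemma summable_ps {c : ℕ → ℝ} (hc : ∀ n, |c n| ≤ 1) {y : ℝ} (hy : |y| < 1) :
    Summable fun n => c n * y ^ n := by
  refine Summable.of_norm_bounded (summable_geometric_of_lt_one (abs_nonneg y) hy) fun n => ?_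
  rw [Real.norm_eq_abs, abs_mul, abs_pow]
  exact mul_le_of_le_one_left (by positivity) (hc n)

lemma summable_dps {c : ℕ → ℝ} (hc : ∀ n, |c n| ≤ 1) {y : ℝ} (hy : |y| < 1) :
    Summable fun n : ℕ => n * c n * y ^ n := by
  have := summable_pow_mul_geometric_of_norm_lt_one 1 (r := |y|) (by simpa using hy)
  refine Summable.of_norm_bounded this fun n => ?_
  rw [Real.norm_eq_abs, abs_mul, abs_mul, abs_pow, Nat.abs_cast, pow_one]
  gcongr
  exact mul_le_of_le_one_right (by positivity) (hc n)

lemma hasDerivAt_ps {c : ℕ → ℝ} (hc : ∀ n, |c n| ≤ 1) {y : ℝ} (hy : |y| < 1) :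
    HasDerivAt (fun z => ∑' n, c n * z ^ n) (∑' n : ℕ, c n * (n * y ^ (n - 1))) y := by
  obtain ⟨r, hr1, hr2⟩ := exists_between hy
  have hr0 : 0 < r := (abs_nonneg y).trans_lt hr1
  have hu : Summable fun n : ℕ => (n : ℝ) * r ^ (n - 1) := by
    have := summable_pow_mul_geometric_of_norm_lt_one 1 (r := r) (by simpa [abs_of_pos hr0] using hr2)
    refine (this.mul_left r⁻¹).congr fun n => ?_
    cases n with
    | zero => simp
    | succ n => simp [pow_succ]; field_simp
  refine hasDerivAt_tsum_of_isPreconnected (g := fun n z => c n * z ^ n)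
    (g' := fun n z => c n * (n * z ^ (n - 1))) (u := fun n : ℕ => (n : ℝ) * r ^ (n - 1))
    (t := Metric.ball 0 r) (y₀ := 0) hu Metric.isOpen_ball
    (convex_ball _ _).isPreconnected (fun n z _ => (hasDerivAt_pow n z).const_mul _) ?_
    (by simpa using hr0) (summable_ps hc (by simp)) (by simpa using hr1)
  intro n z hz
  have hz : |z| < r := by simpa using hz
  rw [Real.norm_eq_abs, abs_mul, abs_mul, abs_pow, Nat.abs_cast]
  refine (mul_le_of_le_one_left (by positivity) (hc n)).trans ?_
  gcongr

lemma mul_dps {c : ℕ → ℝ} (y : ℝ) :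
    y * (∑' n : ℕ, c n * (n * y ^ (n - 1))) = ∑' n : ℕ, n * c n * y ^ n := by
  rw [← tsum_mul_left]
  congr 1; ext n
  cases n with
  | zero => simp
  | succ n => simp [pow_succ]; ring

/-- the derivative system -/
lemma hyp_deriv {α β γ : ℝ} (h1 : 0 < α) (h2 : α ≤ γ) (h3 : 0 ≤ β) (h4 : β ≤ 1) {y : ℝ}
    (hy : |y| < 1) (hy0 : y ≠ 0) :
    HasDerivAt (hypergeom α β γ)
      (((γ - β) * hypergeom α (β - 1) γ y + (β - γ + α * y) * hypergeom α β γ y)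
        / (y * (1 - y))) y := by
  have hc := abs_hco_le (β := β) h1 h2 (by linarith) h4
  have hc' := abs_hco_le (β := β - 1) h1 h2 (by linarith) (by linarith)
  have hd := hasDerivAt_ps hc hy
  have hm := mul_dps (c := hco α β γ) y
  refine HasDerivAt.congr_deriv (f := hypergeom α β γ) hd ?_
  symm
  have hy1 : 1 - y ≠ 0 := by have := (abs_lt.1 hy).2; linarith
  rw [div_eq_iff (by positivity)]
  set D := ∑' n : ℕ, hco α β γ n * (n * y ^ (n - 1))
  have e : D * (y * (1 - y)) = (1 - y) * (y * D) := by ring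
  rw [e, hm]
  have s1 := summable_dps hc hy
  have s2 := summable_ps hc hy
  have s3 := summable_ps hc' hy
  simp only [hypergeom_eq]
  have k1 := s1.hasSum
  have t1 := s1.tsum_eq_zero_add
  have t2 := s2.tsum_eq_zero_add
  have t3 := s3.tsum_eq_zero_add
  have s1' := (summable_nat_add_iff 1).2 s1
  have s2' := (summable_nat_add_iff 1).2 s2
  have s3' := (summable_nat_add_iff 1).2 s3
  have key : ∑' n : ℕ, (((n + 1 : ℕ) : ℝ) * hco α β γ (n + 1) * y ^ (n + 1))
      = y * (∑' n : ℕ, n * hco α β γ n * y ^ n)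
        + ((γ - β) * ∑' n : ℕ, hco α (β - 1) γ (n + 1) * y ^ (n + 1))
        + ((β - γ) * ∑' n : ℕ, hco α β γ (n + 1) * y ^ (n + 1))
        + (α * y) * ∑' n : ℕ, hco α β γ n * y ^ n := by
    simp only [← tsum_mul_left]
    rw [← (s1.mul_left y).tsum_add (s3'.mul_left _),
      ← ((s1.mul_left y).add (s3'.mul_left _)).tsum_add (s2'.mul_left _),
      ← (((s1.mul_left y).add (s3'.mul_left _)).add (s2'.mul_left _)).tsum_add (s2.mul_left _)]
    congr 1; ext n
    have := hco_rec α β γ (h1.trans_le h2) n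
    push_cast
    linear_combination y ^ (n + 1) * this
  simp only [hco_zero] at t2 t3
  simp only [Nat.cast_zero, zero_mul, zero_add, pow_zero, mul_one] at t1 t2 t3
  linear_combination (β - γ) * t2 + (γ - β) * t3 - t1 - key

lemma hyp_deriv' {α β γ : ℝ} (h1 : 0 < α) (h2 : α ≤ γ) (h3 : 0 ≤ β) (h4 : β ≤ 1) {y : ℝ}
    (hy : |y| < 1) (hy0 : y ≠ 0) :
    HasDerivAt (hypergeom α (β - 1) γ)
      ((β - 1) * (hypergeom α β γ y - hypergeom α (β - 1) γ y) / y) y := by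
  have hc := abs_hco_le (β := β) h1 h2 (by linarith) h4
  have hc' := abs_hco_le (β := β - 1) h1 h2 (by linarith) (by linarith)
  have hd := hasDerivAt_ps hc' hy
  have hm := mul_dps (c := hco α (β - 1) γ) y
  refine HasDerivAt.congr_deriv (f := hypergeom α (β - 1) γ) hd ?_
  symm
  rw [div_eq_iff hy0, mul_comm _ y, hm]
  have s1 := summable_dps hc' hy
  have s2 := summable_ps hc hy
  have s3 := summable_ps hc' hy
  simp only [hypergeom_eq]
  rw [← s2.tsum_sub s3, ← tsum_mul_left]
  congr 1; ext n
  have := hco_shift α β γ n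
  linear_combination - y ^ n * this

lemma hyp_cont {α β γ : ℝ} (h1 : 0 < α) (h2 : α ≤ γ) (h3 : -1 ≤ β) (h4 : β ≤ 1) :
    HasDerivAt (hypergeom α β γ) (deriv (hypergeom α β γ) 0) 0 ∧ hypergeom α β γ 0 = 1 := by
  constructor
  · exact (hasDerivAt_ps (abs_hco_le h1 h2 h3 h4) (by simp)).differentiableAt.hasDerivAt
  · rw [hypergeom_eq, tsum_eq_single 0]
    · simp [hco_zero]
    · intro n hn; simp [hn]

lemma elliott_deriv {a b c x : ℝ} (ha : |a| < 1 / 2) (hc : |c| < 1 / 2)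
    (hb : -1 / 2 < b) (hx : x ∈ Ioo (0:ℝ) 1) :
    HasDerivAt (fun x => hypergeom (1 / 2 + a) (-(1 / 2) - c) (a + b + 1) x
        * hypergeom (1 / 2 - a) (1 / 2 + c) (b + c + 1) (1 - x)
      + hypergeom (1 / 2 + a) (1 / 2 - c) (a + b + 1) x
        * hypergeom (-(1 / 2) - a) (1 / 2 + c) (b + c + 1) (1 - x)
      - hypergeom (1 / 2 + a) (1 / 2 - c) (a + b + 1) x
        * hypergeom (1 / 2 - a) (1 / 2 + c) (b + c + 1) (1 - x)) 0 x := by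
  obtain ⟨ha1, ha2⟩ := abs_lt.1 ha
  obtain ⟨hc1, hc2⟩ := abs_lt.1 hc
  obtain ⟨hx1, hx2⟩ := hx
  have hx' : |x| < 1 := by rw [abs_lt]; constructor <;> linarith
  have hx'' : |1 - x| < 1 := by rw [abs_lt]; constructor <;> linarith
  have hs : HasDerivAt (fun x : ℝ => 1 - x) (-1) x := by
    simpa using (hasDerivAt_id x).const_sub 1
  have hn : (1 - x) ≠ 0 := by linarith
  have p1 := hyp_deriv (α := 1 / 2 + a) (β := 1 / 2 - c) (γ := a + b + 1) (by linarith)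
    (by linarith) (by linarith) (by linarith) hx' hx1.ne'
  have p2 := hyp_deriv' (α := 1 / 2 + a) (β := 1 / 2 - c) (γ := a + b + 1) (by linarith)
    (by linarith) (by linarith) (by linarith) hx' hx1.ne'
  have q1 := (hyp_deriv (α := 1 / 2 + c) (β := 1 / 2 - a) (γ := b + c + 1) (by linarith)
    (by linarith) (by linarith) (by linarith) hx'' hn).comp x hs
  have q2 := (hyp_deriv' (α := 1 / 2 + c) (β := 1 / 2 - a) (γ := b + c + 1) (by linarith)
    (by linarith) (by linarith) (by linarith) hx'' hn).comp x hs
  have e1 : 1 / 2 - c - 1 = -(1 / 2) - c := by ring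
  have e2 : 1 / 2 - a - 1 = -(1 / 2) - a := by ring
  rw [e1] at p1 p2
  rw [e2] at q1 q2
  rw [sub_sub_cancel] at q1
  have := ((p2.mul q1).add (p1.mul q2)).sub (p1.mul q1)
  simp only [hypergeom_symm (1 / 2 - a), hypergeom_symm (-(1 / 2) - a)]
  refine this.congr_deriv ?_
  simp only [Function.comp]
  have hx0 := hx1.ne'
  field_simp
  ring

open MeasureTheory in
lemma beta_int {u v : ℝ} (hu : 0 < u) (hv : 0 < v) :
    IntegrableOn (fun t : ℝ => t ^ (u - 1) * (1 - t) ^ (v - 1)) (Ioo 0 1) ∧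
    ∫ t in Ioo (0:ℝ) 1, t ^ (u - 1) * (1 - t) ^ (v - 1) =
      Real.Gamma u * Real.Gamma v / Real.Gamma (u + v) := by
  have hi := Complex.betaIntegral_convergent (u := u) (v := v) (by simpa) (by simpa)
  rw [intervalIntegrable_iff_integrableOn_Ioc_of_le (by simp)] at hi
  have hcongr : ∀ t ∈ Ioo (0:ℝ) 1, ((t : ℂ) ^ ((u : ℂ) - 1) * (1 - (t : ℂ)) ^ ((v : ℂ) - 1)).re
      = t ^ (u - 1) * (1 - t) ^ (v - 1) := by
    intro t ht
    have h1 : ((t ^ (u - 1) * (1 - t) ^ (v - 1) : ℝ) : ℂ)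
        = (t : ℂ) ^ ((u : ℂ) - 1) * (1 - (t : ℂ)) ^ ((v : ℂ) - 1) := by
      rw [Complex.ofReal_mul, Complex.ofReal_cpow ht.1.le, Complex.ofReal_cpow (by linarith [ht.2])]
      push_cast; rfl
    rw [← h1, Complex.ofReal_re]
  have hi2 := hi.mono_set Ioo_subset_Ioc_self
  refine ⟨(integrableOn_congr_fun hcongr measurableSet_Ioo).1 hi2.re, ?_⟩
  have := ProbabilityTheory.beta_eq_betaIntegralReal u v hu hv
  rw [ProbabilityTheory.beta] at this
  rw [this, Complex.betaIntegral, intervalIntegral.integral_of_le (by norm_num),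
    integral_Ioc_eq_integral_Ioo, ← RCLike.re_to_complex, ← integral_re hi2]
  exact (setIntegral_congr_fun measurableSet_Ioo hcongr).symm

lemma binom_coeff (α z : ℝ) (n : ℕ) :
    (ascPochhammer ℝ n).eval α / n.factorial * z ^ n =
      binomialSeries ℝ (-α) n fun _ => -z := by
  rw [binomialSeries_apply]
  simp only [Ring.choose_eq_smul, Polynomial.descPochhammer_smeval_eq_ascPochhammer,
    Polynomial.ascPochhammer_smeval_cast, Polynomial.ascPochhammer_smeval_eq_eval]
  have : (ascPochhammer ℝ n).eval α = (-1) ^ n * (ascPochhammer ℝ n).eval (-α - n + 1) := by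
    have := ascPochhammer_eval_neg_eq_descPochhammer ℝ (-α) n
    rw [neg_neg] at this
    rw [this, descPochhammer_eval_eq_ascPochhammer]
  rw [this, List.ofFn_const, List.prod_replicate, neg_pow z, smul_eq_mul, smul_eq_mul]
  ring

lemma binom_hasSum (α : ℝ) {z : ℝ} (hz : |z| < 1) :
    HasSum (fun n : ℕ => (ascPochhammer ℝ n).eval α / n.factorial * z ^ n) ((1 - z) ^ (-α)) := by
  have h := (Real.one_add_rpow_hasFPowerSeriesOnBall_zero (a := -α)).hasSum (y := -z)
    (by simpa [enorm_eq_nnnorm, ← NNReal.coe_lt_one] using hz)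
  rw [zero_add, ← sub_eq_add_neg] at h
  have e : (fun n : ℕ => (ascPochhammer ℝ n).eval α / n.factorial * z ^ n) =
      fun n => binomialSeries ℝ (-α) n fun _ => -z := by
    funext n
    exact binom_coeff α z n
  rw [e]
  exact h

lemma gamma_poch {u : ℝ} (hu : 0 < u) (n : ℕ) :
    Real.Gamma (u + n) = (ascPochhammer ℝ n).eval u * Real.Gamma u := by
  induction n with
  | zero => simp
  | succ n ih =>
    push_cast
    rw [← add_assoc, Real.Gamma_add_one (by positivity), ih, ascPochhammer_succ_eval]
    ring

open MeasureTheory in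
lemma euler_int {α β γ y : ℝ} (h1 : 0 < β) (h2 : β < γ) (h3 : -1 ≤ α) (h4 : α ≤ 1)
    (hy0 : 0 ≤ y) (hy : y < 1) :
    hypergeom β α γ y * (Real.Gamma β * Real.Gamma (γ - β) / Real.Gamma γ) =
      ∫ t in Ioo (0:ℝ) 1, t ^ (β - 1) * (1 - t) ^ (γ - β - 1) * (1 - t * y) ^ (-α) := by
  have hg := h1.trans h2
  have hy' : |y| < 1 := by rwa [abs_of_nonneg hy0]
  have hv : 0 < γ - β := by linarith
  set B := Real.Gamma β * Real.Gamma (γ - β) / Real.Gamma γ with hB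
  let F : ℕ → ℝ → ℝ := fun n t => ((ascPochhammer ℝ n).eval α / n.factorial * y ^ n) *
    (t ^ (β + n - 1) * (1 - t) ^ (γ - β - 1))
  have hn (n : ℕ) : 0 < β + n := by positivity
  have hFi (n : ℕ) : Integrable (F n) (volume.restrict (Ioo 0 1)) :=
    (beta_int (hn n) hv).1.const_mul _
  have hco_eq (n : ℕ) : (ascPochhammer ℝ n).eval α / n.factorial *
      (Real.Gamma (β + n) * Real.Gamma (γ - β) / Real.Gamma (β + n + (γ - β))) =
      hco β α γ n * B := by
    have e : β + n + (γ - β) = γ + n := by ring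
    rw [e, gamma_poch h1, gamma_poch hg, hB, hco]
    have := (poch_pos hg n).ne'
    have := (Real.Gamma_pos_of_pos hg).ne'
    have h3 : (n.factorial : ℝ) ≠ 0 := by positivity
    field_simp
  have hFint (n : ℕ) : ∫ t in Ioo (0:ℝ) 1, F n t = hco β α γ n * y ^ n * B := by
    simp only [F]
    rw [integral_const_mul, (beta_int (hn n) hv).2]
    linear_combination y ^ n * hco_eq n
  have hFnorm (n : ℕ) : ∫ t in Ioo (0:ℝ) 1, ‖F n t‖ = |hco β α γ n * y ^ n * B| := by
    rw [← hFint, ← Real.norm_eq_abs]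
    simp only [F]
    rw [integral_const_mul, norm_mul, (beta_int (hn n) hv).2]
    have : ∀ t ∈ Ioo (0:ℝ) 1, ‖((ascPochhammer ℝ n).eval α / n.factorial * y ^ n) *
      (t ^ (β + n - 1) * (1 - t) ^ (γ - β - 1))‖ =
      ‖(ascPochhammer ℝ n).eval α / n.factorial * y ^ n‖ *
        (t ^ (β + n - 1) * (1 - t) ^ (γ - β - 1)) := by
      intro t ht
      have h0 := ht.1
      have h0' : 0 < 1 - t := by linarith [ht.2]
      rw [norm_mul, Real.norm_of_nonneg (r := t ^ (β + n - 1) * (1 - t) ^ (γ - β - 1))]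
      positivity
    rw [setIntegral_congr_fun measurableSet_Ioo this, integral_const_mul,
      (beta_int (hn n) hv).2]
    have g1 := Real.Gamma_pos_of_pos (hn n)
    have g2 := Real.Gamma_pos_of_pos hv
    have g3 := Real.Gamma_pos_of_pos (add_pos (hn n) hv)
    rw [Real.norm_of_nonneg (r := _ / _) (by positivity)]
  have hsum := summable_ps (abs_hco_le h1 h2.le h3 h4) hy'
  have key := hasSum_integral_of_summable_integral_norm hFi
    (by simp only [hFnorm]; exact (hsum.mul_right B).abs)
  simp only [hFint] at key
  rw [hypergeom_eq, ← tsum_mul_right, key.tsum_eq]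
  refine setIntegral_congr_fun measurableSet_Ioo fun t ht => ?_
  have hty : |t * y| < 1 := by
    rw [abs_of_nonneg (mul_nonneg ht.1.le hy0)]
    nlinarith [ht.1, ht.2]
  have := (binom_hasSum α hty).mul_left (t ^ (β - 1) * (1 - t) ^ (γ - β - 1))
  rw [← this.tsum_eq]
  congr 1; ext n
  simp only [F]
  rw [show β + n - 1 = (β - 1) + n by ring, Real.rpow_add_natCast ht.1.ne', mul_pow]
  ring

open MeasureTheory Topology in
lemma gauss_lim {α β γ : ℝ} (h1 : 0 < β) (h2 : β < γ) (h3 : -1 ≤ α) (h4 : α ≤ 0) :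
    Tendsto (fun y => hypergeom β α γ y) (𝓝[<] 1)
      (𝓝 (Real.Gamma γ * Real.Gamma (γ - β - α) / (Real.Gamma (γ - α) * Real.Gamma (γ - β)))) := by
  have hv : 0 < γ - β := by linarith
  have hv' : 0 < γ - β - α := by linarith
  have hev : ∀ᶠ y in 𝓝[<] (1:ℝ), y ∈ Ioo (0:ℝ) 1 := Ioo_mem_nhdsLT (by norm_num)
  have hlim : Tendsto (fun y : ℝ => ∫ t in Ioo (0:ℝ) 1,
      t ^ (β - 1) * (1 - t) ^ (γ - β - 1) * (1 - t * y) ^ (-α)) (𝓝[<] 1)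
      (𝓝 (∫ t in Ioo (0:ℝ) 1,
      t ^ (β - 1) * (1 - t) ^ (γ - β - 1) * (1 - t * 1) ^ (-α))) := by
    refine tendsto_integral_filter_of_dominated_convergence
      (fun t => t ^ (β - 1) * (1 - t) ^ (γ - β - 1)) ?_ ?_ (beta_int h1 hv).1 ?_
    · exact Eventually.of_forall fun y => Measurable.aestronglyMeasurable (by fun_prop)
    · filter_upwards [hev] with y hy
      refine (ae_restrict_iff' measurableSet_Ioo).2 (Eventually.of_forall fun t ht => ?_)
      have h0 := ht.1
      have h0' : 0 < 1 - t := by linarith [ht.2]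
      have hty : 0 ≤ 1 - t * y := by nlinarith [ht.2, hy.1, hy.2]
      have hty' : 1 - t * y ≤ 1 := by nlinarith [ht.2, hy.1, hy.2]
      rw [Real.norm_of_nonneg (by positivity)]
      exact mul_le_of_le_one_right (by positivity) (Real.rpow_le_one hty hty' (by linarith))
    · refine (ae_restrict_iff' measurableSet_Ioo).2 (Eventually.of_forall fun t ht => ?_)
      have h0' : 1 - t * 1 ≠ 0 := by linarith [ht.2]
      have : ContinuousAt (fun y : ℝ => t ^ (β - 1) * (1 - t) ^ (γ - β - 1) * (1 - t * y) ^ (-α)) 1 :=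
        continuousAt_const.mul (ContinuousAt.rpow_const (by fun_prop) (Or.inl h0'))
      exact this.tendsto.mono_left nhdsWithin_le_nhds
  have hval : ∫ t in Ioo (0:ℝ) 1,
      t ^ (β - 1) * (1 - t) ^ (γ - β - 1) * (1 - t * 1) ^ (-α) =
      Real.Gamma β * Real.Gamma (γ - β - α) / Real.Gamma (γ - α) := by
    have := (beta_int h1 hv').2
    rw [show β + (γ - β - α) = γ - α by ring] at this
    rw [← this]
    refine setIntegral_congr_fun measurableSet_Ioo fun t ht => ?_
    have h0' : 0 < 1 - t := by linarith [ht.2]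
    simp only [mul_one]
    rw [mul_assoc, ← Real.rpow_add h0']
    congr 2; ring
  rw [hval] at hlim
  have g1 := (Real.Gamma_pos_of_pos h1).ne'
  have g2 := (Real.Gamma_pos_of_pos hv).ne'
  have g3 := (Real.Gamma_pos_of_pos (h1.trans h2)).ne'
  have g4 := (Real.Gamma_pos_of_pos (show 0 < γ - α by linarith)).ne'
  have := (hlim.div_const (Real.Gamma β * Real.Gamma (γ - β) / Real.Gamma γ)).congr' (f₂ := hypergeom β α γ) ?_
  · convert this using 2
    field_simp
  · filter_upwards [hev] with y hy
    rw [← euler_int h1 h2 h3 (by linarith) hy.1.le hy.2]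
    field_simp

lemma hyp_bound {α β γ y : ℝ} (h1 : 0 < β) (h2 : β < γ) (h3 : 0 < α) (h4 : α ≤ 1)
    (hy0 : 0 ≤ y) (hy : y < 1) :
    0 ≤ hypergeom β α γ y ∧ hypergeom β α γ y ≤ (1 - y) ^ (-α) := by
  have hy' : |y| < 1 := by rwa [abs_of_nonneg hy0]
  have hp (n : ℕ) := poch_pos h1 n
  have hp2 (n : ℕ) := poch_pos h3 n
  have hp3 (n : ℕ) := poch_pos (h1.trans h2) n
  constructor
  · exact tsum_nonneg fun n => by
      have := hp n; have := hp2 n; have := hp3 n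
      positivity
  · refine hasSum_le (fun n => ?_) (summable_ps (abs_hco_le h1 h2.le (by linarith) h4) hy').hasSum
      (binom_hasSum α hy')
    have := hp n; have := hp2 n; have := hp3 n
    gcongr
    unfold hco
    rw [mul_div_mul_comm]
    exact mul_le_of_le_one_left (by positivity)
      (div_le_one_of_le₀ (poch_mono h1 h2.le n) (by positivity))

open Topology in
theorem elliott_identity (a b c x : ℝ) (ha : |a| < 1 / 2) (hc : |c| < 1 / 2)
    (hb : -1 / 2 < b) (hx : x ∈ Ioo (0:ℝ) 1) :
    hypergeom (1 / 2 + a) (-(1 / 2) - c) (a + b + 1) x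
        * hypergeom (1 / 2 - a) (1 / 2 + c) (b + c + 1) (1 - x)
      + hypergeom (1 / 2 + a) (1 / 2 - c) (a + b + 1) x
        * hypergeom (-(1 / 2) - a) (1 / 2 + c) (b + c + 1) (1 - x)
      - hypergeom (1 / 2 + a) (1 / 2 - c) (a + b + 1) x
        * hypergeom (1 / 2 - a) (1 / 2 + c) (b + c + 1) (1 - x)
      = Real.Gamma (a + b + 1) * Real.Gamma (b + c + 1)
        / (Real.Gamma (a + b + c + 3 / 2) * Real.Gamma (b + 1 / 2)) := by
  obtain ⟨ha1, ha2⟩ := abs_lt.1 ha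
  obtain ⟨hc1, hc2⟩ := abs_lt.1 hc
  set E : ℝ → ℝ := fun x => hypergeom (1 / 2 + a) (-(1 / 2) - c) (a + b + 1) x
        * hypergeom (1 / 2 - a) (1 / 2 + c) (b + c + 1) (1 - x)
      + hypergeom (1 / 2 + a) (1 / 2 - c) (a + b + 1) x
        * hypergeom (-(1 / 2) - a) (1 / 2 + c) (b + c + 1) (1 - x)
      - hypergeom (1 / 2 + a) (1 / 2 - c) (a + b + 1) x
        * hypergeom (1 / 2 - a) (1 / 2 + c) (b + c + 1) (1 - x) with hE
  have hconst : ∀ z ∈ Ioo (0:ℝ) 1, E z = E x := fun z hz =>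
    isOpen_Ioo.is_const_of_deriv_eq_zero isPreconnected_Ioo
      (fun w hw => (elliott_deriv ha hc hb hw).differentiableAt.differentiableWithinAt)
      (fun w hw => (elliott_deriv ha hc hb hw).deriv) hz hx
  have hev : ∀ᶠ y in 𝓝[>] (0:ℝ), y ∈ Ioo (0:ℝ) 1 := Ioo_mem_nhdsGT (by norm_num)
  have hl1 : Tendsto E (𝓝[>] 0) (𝓝 (E x)) :=
    tendsto_const_nhds.congr' (hev.mono fun z hz => (hconst z hz).symm)
  refine tendsto_nhds_unique hl1 ?_
  obtain ⟨d1, v1⟩ := hyp_cont (α := 1 / 2 + a) (β := 1 / 2 - c) (γ := a + b + 1) (by linarith)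
    (by linarith) (by linarith) (by linarith)
  obtain ⟨d2, v2⟩ := hyp_cont (α := 1 / 2 + a) (β := -(1 / 2) - c) (γ := a + b + 1) (by linarith)
    (by linarith) (by linarith) (by linarith)
  have hsub : Tendsto (fun z : ℝ => 1 - z) (𝓝[>] 0) (𝓝[<] 1) := by
    refine tendsto_nhdsWithin_iff.2 ⟨?_, ?_⟩
    · have : Tendsto (fun z : ℝ => 1 - z) (𝓝 0) (𝓝 (1 - 0)) := by
        apply Continuous.tendsto; fun_prop
      rw [sub_zero] at this
      exact this.mono_left nhdsWithin_le_nhds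
    · filter_upwards [hev] with z hz
      simp [hz.1]
  have hG := (gauss_lim (α := -(1 / 2) - a) (β := 1 / 2 + c) (γ := b + c + 1) (by linarith)
    (by linarith) (by linarith) (by linarith)).comp hsub
  have hQ : Tendsto (fun z => z * hypergeom (1 / 2 + c) (1 / 2 - a) (b + c + 1) (1 - z))
      (𝓝[>] 0) (𝓝 0) := by
    have hz : Tendsto (fun z : ℝ => z ^ (1 / 2 + a)) (𝓝[>] 0) (𝓝 0) := by
      have : ContinuousAt (fun z : ℝ => z ^ (1 / 2 + a)) 0 :=
        Real.continuousAt_rpow_const _ _ (Or.inr (by linarith))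
      have := this.tendsto
      rw [Real.zero_rpow (by linarith)] at this
      exact this.mono_left nhdsWithin_le_nhds
    refine tendsto_of_tendsto_of_tendsto_of_le_of_le' tendsto_const_nhds hz ?_ ?_
    · filter_upwards [hev] with z hz
      have := (hyp_bound (α := 1 / 2 - a) (β := 1 / 2 + c) (γ := b + c + 1) (y := 1 - z)
        (by linarith) (by linarith) (by linarith) (by linarith)
        (by linarith [hz.2]) (by linarith [hz.1])).1
      exact mul_nonneg hz.1.le this
    · filter_upwards [hev] with z hz
      have := (hyp_bound (α := 1 / 2 - a) (β := 1 / 2 + c) (γ := b + c + 1) (y := 1 - z)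
        (by linarith) (by linarith) (by linarith) (by linarith)
        (by linarith [hz.2]) (by linarith [hz.1])).2
      rw [sub_sub_cancel] at this
      refine (mul_le_mul_of_nonneg_left this hz.1.le).trans_eq ?_
      rw [show 1 / 2 + a = 1 + -(1 / 2 - a) by ring, Real.rpow_add hz.1, Real.rpow_one]
  have hS := (d2.sub d1).tendsto_slope_zero_right
  have hP := d1.continuousAt.tendsto.mono_left (nhdsWithin_le_nhds (s := Ioi 0))
  have hT := (hS.mul hQ).add (hP.mul hG)
  rw [v1, mul_zero, zero_add, one_mul] at hT
  have e0 : b + c + 1 - (1 / 2 + c) - (-(1 / 2) - a) = a + b + 1 := by ring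
  have e1 : b + c + 1 - (-(1 / 2) - a) = a + b + c + 3 / 2 := by ring
  have e2 : b + c + 1 - (1 / 2 + c) = b + 1 / 2 := by ring
  rw [e0, e1, e2, mul_comm (Real.Gamma (b + c + 1))] at hT
  refine hT.congr' ?_
  filter_upwards [hev] with z hz
  have hz0 := hz.1.ne'
  simp only [hE, Function.comp, zero_add, smul_eq_mul, Pi.sub_apply, v1, v2,
    hypergeom_symm (1 / 2 - a), hypergeom_symm (-(1 / 2) - a)]
  field_simp
  ring
end

section
/- Let p be a real number with p < 0 or p > 1, let q, r ∈ (1,∞), and let k ∈ (0,1). Set k' = (1−k^q)^{1/r}. Then 0 ≤ (K_{p,q,r*}(k) − E_{p,q,r*}(k))·K_{p,r,q*}(k') ≤ (π_{p,r}/2)·k·K_{p,q,r*}(k). -/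
open Real MeasureTheory Set Filter

/-- The Euler Beta function. -/
noncomputable def Beta (x y : ℝ) : ℝ := Real.Gamma x * Real.Gamma y / Real.Gamma (x + y)

/-- The generalized complete elliptic integral of the first kind. -/
noncomputable def genK (p q r k : ℝ) : ℝ :=
  ∫ t in (0:ℝ)..1, (1 - t ^ q) ^ (-(1 / p)) * (1 - k ^ q * t ^ q) ^ (-(1 / r))

/-- The generalized complete elliptic integral of the second kind.
Here `1 - 1/r` is `1/r*` for the Hölder conjugate `r*` of `r`. -/
noncomputable def genE (p q r k : ℝ) : ℝ :=
  ∫ t in (0:ℝ)..1, (1 - k ^ q * t ^ q) ^ (1 - 1 / r) * (1 - t ^ q) ^ (-(1 / p))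

lemma aux_int (a q : ℝ) (ha : a < 1) (hq : 1 < q) :
    IntervalIntegrable (fun t : ℝ => (1 - t ^ q) ^ (-a)) volume 0 1 := by
  have h1 : IntervalIntegrable (fun t : ℝ => (1 - t) ^ (-(max a 0))) volume 0 1 := by
    have h := (intervalIntegral.intervalIntegrable_rpow' (a := 0) (b := 1) (r := -(max a 0))
      (by have : max a 0 < 1 := max_lt ha one_pos
          linarith)).comp_sub_left 1
    simpa using h.symm
  refine h1.mono_fun ?_ ?_
  · exact (by fun_prop : Measurable (fun t : ℝ => (1 - t ^ q) ^ (-a))).aestronglyMeasurable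
  · rw [uIoc_of_le zero_le_one, ← restrict_Ioo_eq_restrict_Ioc]
    refine (ae_restrict_iff' measurableSet_Ioo).2 (Eventually.of_forall fun t ht => ?_)
    have htq : t ^ q ≤ t := by
      simpa using Real.rpow_le_rpow_of_exponent_ge ht.1 ht.2.le hq.le
    have h0 : 0 < t ^ q := Real.rpow_pos_of_pos ht.1 q
    have h2 : 0 < 1 - t := by linarith [ht.2]
    have h3 : 0 < 1 - t ^ q := by linarith
    beta_reduce
    rw [Real.norm_of_nonneg (Real.rpow_nonneg h3.le _),
      Real.norm_of_nonneg (Real.rpow_nonneg h2.le _)]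
    calc (1 - t ^ q) ^ (-a) ≤ (1 - t ^ q) ^ (-(max a 0)) :=
          Real.rpow_le_rpow_of_exponent_ge h3 (by linarith) (by linarith [le_max_left a 0])
      _ ≤ (1 - t) ^ (-(max a 0)) :=
          Real.rpow_le_rpow_of_nonpos h2 (by linarith) (by linarith [le_max_right a 0])

lemma aux_cont (m q c : ℝ) (hm : 0 ≤ m) (hm1 : m < 1) (hq : 1 < q) :
    ContinuousOn (fun t : ℝ => (1 - m * t ^ q) ^ c) (uIcc (0:ℝ) 1) := by
  rw [uIcc_of_le zero_le_one]
  refine ContinuousOn.rpow_const ?_ ?_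
  · exact (continuous_const.sub (continuous_const.mul
      (Real.continuous_rpow_const (by linarith)))).continuousOn
  · intro t ht
    left
    have : t ^ q ≤ 1 := Real.rpow_le_one ht.1 ht.2 (by linarith)
    have := mul_le_of_le_one_right hm this
    linarith

theorem genK_sub_genE_mul_genK_bounds
    (p q r : ℝ) (hp : p < 0 ∨ 1 < p) (hq : 1 < q) (hr : 1 < r)
    (qs rs : ℝ) (hqs : 1 / q + 1 / qs = 1) (hrs : 1 / r + 1 / rs = 1)
    (k : ℝ) (hk : k ∈ Ioo (0:ℝ) 1) (k' : ℝ) (hk' : k' = (1 - k ^ q) ^ (1 / r))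
    (pipr : ℝ) (hpipr : pipr = 2 * ∫ t in (0:ℝ)..1, (1 - t ^ r) ^ (-(1 / p))) :
    0 ≤ (genK p q rs k - genE p q rs k) * genK p r qs k'
    ∧ (genK p q rs k - genE p q rs k) * genK p r qs k'
        ≤ (pipr / 2) * k * genK p q rs k := by
  have ha : 1 / p < 1 := by
    rcases hp with h | h
    · linarith [one_div_neg.2 h]
    · rw [div_lt_one (by linarith)]; exact h
  obtain ⟨hk0, hk1⟩ := hk
  have hm0 : 0 < k ^ q := Real.rpow_pos_of_pos hk0 q
  have hm1 : k ^ q < 1 := Real.rpow_lt_one hk0.le hk1 (by linarith)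
  have hkr : k' ^ r = 1 - k ^ q := by
    rw [hk', ← Real.rpow_mul (by linarith), one_div_mul_cancel (by linarith), Real.rpow_one]
  -- pointwise facts
  have pt : ∀ s t : ℝ, 1 < s → t ∈ Icc (0:ℝ) 1 → 0 ≤ t ^ s ∧ t ^ s ≤ 1 := fun s t hs ht =>
    ⟨Real.rpow_nonneg ht.1 _, Real.rpow_le_one ht.1 ht.2 (by linarith)⟩
  have I1 : IntervalIntegrable (fun t : ℝ => (1 - t ^ q) ^ (-(1 / p)) *
      (1 - k ^ q * t ^ q) ^ (-(1 / rs))) volume 0 1 :=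
    (aux_int _ q ha hq).mul_continuousOn (aux_cont _ q _ hm0.le hm1 hq)
  have I2 : IntervalIntegrable (fun t : ℝ => (1 - k ^ q * t ^ q) ^ (1 - 1 / rs) *
      (1 - t ^ q) ^ (-(1 / p))) volume 0 1 :=
    (aux_int _ q ha hq).continuousOn_mul (aux_cont _ q _ hm0.le hm1 hq)
  have J0 := aux_int _ r ha hr
  have J1 : IntervalIntegrable (fun t : ℝ => (1 - t ^ r) ^ (-(1 / p)) *
      (1 - k' ^ r * t ^ r) ^ (-(1 / qs))) volume 0 1 :=
    J0.mul_continuousOn (aux_cont _ r _ (by linarith) (by linarith) hr)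
  have key : ∀ t ∈ Icc (0:ℝ) 1, (1 - k ^ q * t ^ q) ^ (1 - 1 / rs) * (1 - t ^ q) ^ (-(1 / p))
      = (1 - k ^ q * t ^ q) * ((1 - t ^ q) ^ (-(1 / p)) * (1 - k ^ q * t ^ q) ^ (-(1 / rs))) := by
    intro t ht
    obtain ⟨h0, h1⟩ := pt q t hq ht
    have : 0 < 1 - k ^ q * t ^ q := by nlinarith
    rw [sub_eq_add_neg 1 (1 / rs), Real.rpow_add this, Real.rpow_one]
    ring
  have nn : ∀ t ∈ Icc (0:ℝ) 1,
      0 ≤ (1 - t ^ q) ^ (-(1 / p)) * (1 - k ^ q * t ^ q) ^ (-(1 / rs)) := by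
    intro t ht
    obtain ⟨h0, h1⟩ := pt q t hq ht
    exact mul_nonneg (Real.rpow_nonneg (by linarith) _) (Real.rpow_nonneg (by nlinarith) _)
  have A0 : 0 ≤ genK p q rs k - genE p q rs k := by
    unfold genK genE
    rw [sub_nonneg]
    refine intervalIntegral.integral_mono_on zero_le_one I2 I1 fun t ht => ?_
    rw [key t ht]
    obtain ⟨h0, h1⟩ := pt q t hq ht
    exact mul_le_of_le_one_left (nn t ht) (by nlinarith)
  have A1 : genK p q rs k - genE p q rs k ≤ k ^ q * genK p q rs k := by
    unfold genK genE
    rw [← intervalIntegral.integral_sub I1 I2, ← intervalIntegral.integral_const_mul]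
    refine intervalIntegral.integral_mono_on zero_le_one (I1.sub I2) (I1.const_mul _) fun t ht => ?_
    rw [key t ht]
    obtain ⟨h0, h1⟩ := pt q t hq ht
    have := mul_le_mul_of_nonneg_right (mul_le_of_le_one_right hm0.le h1) (nn t ht)
    linarith
  have B0 : 0 ≤ genK p r qs k' := by
    unfold genK
    refine intervalIntegral.integral_nonneg zero_le_one fun t ht => ?_
    obtain ⟨h0, h1⟩ := pt r t hr ht
    rw [hkr]
    exact mul_nonneg (Real.rpow_nonneg (by linarith) _) (Real.rpow_nonneg (by nlinarith) _)
  have hc : 0 ≤ 1 / qs := by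
    have : 1 / q ≤ 1 := by rw [div_le_one (by linarith)]; exact hq.le
    linarith
  have B1 : genK p r qs k' ≤ (k ^ q) ^ (-(1 / qs)) * (pipr / 2) := by
    have : pipr / 2 = ∫ t in (0:ℝ)..1, (1 - t ^ r) ^ (-(1 / p)) := by rw [hpipr]; ring
    unfold genK
    rw [this, ← intervalIntegral.integral_const_mul]
    refine intervalIntegral.integral_mono_on zero_le_one J1 (J0.const_mul _) fun t ht => ?_
    obtain ⟨h0, h1⟩ := pt r t hr ht
    rw [hkr, mul_comm]
    refine mul_le_mul_of_nonneg_right ?_ (Real.rpow_nonneg (by linarith) _)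
    exact Real.rpow_le_rpow_of_nonpos hm0 (by nlinarith) (by linarith)
  refine ⟨mul_nonneg A0 B0, (mul_le_mul A1 B1 B0 (A0.trans A1)).trans_eq ?_⟩
  have : k ^ q * (k ^ q) ^ (-(1 / qs)) = k := by
    have e : q + q * -(1 / qs) = 1 := by
      have h : 1 / qs = 1 - 1 / q := by linarith
      rw [h]; field_simp; ring
    rw [← Real.rpow_mul hk0.le, ← Real.rpow_add hk0, e, Real.rpow_one]
  linear_combination (genK p q rs k * (pipr / 2)) * this
end
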